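/- Shape graphs are learnable from typed graphs: there exists a function learner mapping every typed graph to a shape graph such that (Soundness) for every typed graph G ∈ G1 = ⋃{ L(S) : S ∈ ShEx0 }, G ∈ L(learner(G)); and (Completeness) for every shape graph S ∈ ShEx0 there exists a characteristic typed graph G ∈ L(S) such that for every G' ∈ L(S), learner(G ⊎ G') ≡ S. -/

import Mathlib

noncomputable section

namespace ShEx0

/-- An interval `[lo; hi]` with `lo : ℕ` and `hi : ℕ∞`; it denotes `{k : ℕ | lo ≤ k ∧ k ≤ hi}`. -/
def IvMem (p : ℕ × ℕ∞) (k : ℕ) : Prop := p.1 ≤ k ∧ (k : ℕ∞) ≤ p.2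

/-- The basic intervals `M = {[0;0],[0;1],[1;1],[1;∞],[0;∞]}`. -/
def IvBasic (p : ℕ × ℕ∞) : Prop := p.1 ≤ 1 ∧ (p.2 ≤ 1 ∨ p.2 = ⊤)

/-- A shape graph: an assignment of a basic interval to every triple (type, label, type). -/
structure ShapeGraph (Lab Ty : Type) where
  arity : Ty → Lab → Ty → ℕ × ℕ∞
  basic : ∀ t a s, IvBasic (arity t a s)

/-- A typed graph over node set `ℕ`, with labeled edges and a typing function. -/
structure TypedGraph (Lab Ty : Type) where
  nodes : Set ℕ
  edges : Set (ℕ × Lab × ℕ)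
  typing : ℕ → Set Ty
  nodes_finite : nodes.Finite
  edges_sub : ∀ e ∈ edges, e.1 ∈ nodes ∧ e.2.2 ∈ nodes

variable {Lab Ty : Type}

/-- Outbound edges of a node. -/
def TypedGraph.out (G : TypedGraph Lab Ty) (n : ℕ) : Set (ℕ × Lab × ℕ) :=
  {e | e ∈ G.edges ∧ e.1 = n}

/-- `R` is a post-fixpoint of the satisfaction operator: each `(n,t) ∈ R` admits a witness `λ`. -/
def IsPostfix (S : ShapeGraph Lab Ty) (G : TypedGraph Lab Ty) (R : ℕ → Ty → Prop) : Prop :=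
  ∀ n t, R n t → ∃ lam : ℕ × Lab × ℕ → Ty,
    (∀ e ∈ G.out n, R e.2.2 (lam e)) ∧
    ∀ a s, IvMem (S.arity t a s) (Set.ncard {e | e ∈ G.out n ∧ e.2.1 = a ∧ lam e = s})

/-- The satisfaction relation: the greatest relation satisfying the unfolding condition,
    i.e. the union of all post-fixpoints. -/
def Sat (S : ShapeGraph Lab Ty) (G : TypedGraph Lab Ty) (n : ℕ) (t : Ty) : Prop :=
  ∃ R, IsPostfix S G R ∧ R n t

/-- The language of a shape graph: typed graphs whose typing is exactly the satisfaction
    relation and is proper (nonempty on every node). -/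
def Lang (S : ShapeGraph Lab Ty) : Set (TypedGraph Lab Ty) :=
  {G | (∀ n ∈ G.nodes, G.typing n = {t | Sat S G n t}) ∧ ∀ n ∈ G.nodes, (G.typing n).Nonempty}

/-- `t1 ⊆_S t2`. -/
def TypeSub (S : ShapeGraph Lab Ty) (t1 t2 : Ty) : Prop :=
  ∀ G ∈ Lang S, ∀ n ∈ G.nodes, t1 ∈ G.typing n → t2 ∈ G.typing n

/-- `t1 =_S t2`. -/
def TypeEq (S : ShapeGraph Lab Ty) (t1 t2 : Ty) : Prop :=
  TypeSub S t1 t2 ∧ TypeSub S t2 t1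

/-- `Typesets(S)`. -/
def Typesets (S : ShapeGraph Lab Ty) : Set (Set Ty) :=
  {T | ∃ G ∈ Lang S, ∃ n ∈ G.nodes, G.typing n = T}

/-- The lower endpoint of the arity in a context `C = (t,a)`. -/
def minarity (S : ShapeGraph Lab Ty) (C : Ty × Lab) (s : Ty) : ℕ := (S.arity C.1 C.2 s).1

/-- The upper endpoint of the arity in a context `C = (t,a)`. -/
def maxarity (S : ShapeGraph Lab Ty) (C : Ty × Lab) (s : Ty) : ℕ∞ := (S.arity C.1 C.2 s).2

/-- `cnt^C_G(n,T)`: number of `C.2`-successors of `n` whose typeset is exactly `T`. -/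
def cntT (G : TypedGraph Lab Ty) (C : Ty × Lab) (n : ℕ) (T : Set Ty) : ℕ :=
  Set.ncard {m | (n, C.2, m) ∈ G.edges ∧ G.typing m = T}

/-- `cnt^C_G(n,s)`: number of `C.2`-successors of `n` having type `s`. -/
def cntt (G : TypedGraph Lab Ty) (C : Ty × Lab) (n : ℕ) (s : Ty) : ℕ :=
  Set.ncard {m | (n, C.2, m) ∈ G.edges ∧ s ∈ G.typing m}

/-- The set of counts `cnt^C_G(n,T)` over nodes `n` having type `C.1`. -/
def occT (G : TypedGraph Lab Ty) (C : Ty × Lab) (T : Set Ty) : Set ℕ :=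
  {k | ∃ n ∈ G.nodes, C.1 ∈ G.typing n ∧ cntT G C n T = k}

/-- The set of counts `cnt^C_G(n,s)` over nodes `n` having type `C.1`. -/
def occt (G : TypedGraph Lab Ty) (C : Ty × Lab) (s : Ty) : Set ℕ :=
  {k | ∃ n ∈ G.nodes, C.1 ∈ G.typing n ∧ cntt G C n s = k}

def minoccurT (G : TypedGraph Lab Ty) (C : Ty × Lab) (T : Set Ty) : ℕ := sInf (occT G C T)
def maxoccurT (G : TypedGraph Lab Ty) (C : Ty × Lab) (T : Set Ty) : ℕ := sSup (occT G C T)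
def minoccurt (G : TypedGraph Lab Ty) (C : Ty × Lab) (s : Ty) : ℕ := sInf (occt G C s)
def maxoccurt (G : TypedGraph Lab Ty) (C : Ty × Lab) (s : Ty) : ℕ := sSup (occt G C s)

/-- `G` is weakly characteristic for `S`. -/
def WeaklyChar (S : ShapeGraph Lab Ty) (G : TypedGraph Lab Ty) : Prop :=
  G ∈ Lang S ∧
  (∀ T ∈ Typesets S, ∃ n ∈ G.nodes, G.typing n = T) ∧
  ∀ C : Ty × Lab, ∀ T ∈ Typesets S,
    (∃ n ∈ G.nodes, C.1 ∈ G.typing n ∧ cntT G C n T = ∑ᶠ t' ∈ T, minarity S C t') ∧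
    (∃ n' ∈ G.nodes, C.1 ∈ G.typing n' ∧
      ((∑ᶠ t' ∈ T, maxarity S C t') ≠ ⊤ →
          (cntT G C n' T : ℕ∞) = ∑ᶠ t' ∈ T, maxarity S C t') ∧
      ((∑ᶠ t' ∈ T, maxarity S C t') = ⊤ → T.ncard + 1 ≤ cntT G C n' T))

section Rules

variable (lt : Ty → Ty → Prop)

/-- A single application of rule (R1) in some context. -/
def R1Step (S S' : ShapeGraph Lab Ty) : Prop :=
  ∃ C : Ty × Lab, ∃ t t' : Ty,
    TypeEq S t t' ∧ lt t t' ∧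
    minarity S C t = 0 ∧ minarity S C t' = 1 ∧
    S'.arity C.1 C.2 t = ((1 : ℕ), (S.arity C.1 C.2 t).2) ∧
    S'.arity C.1 C.2 t' = ((0 : ℕ), (S.arity C.1 C.2 t').2) ∧
    ∀ u a s, ¬((u, a) = C ∧ (s = t ∨ s = t')) → S'.arity u a s = S.arity u a s

/-- A single application of rule (R2) in some context. -/
def R2Step (S S' : ShapeGraph Lab Ty) : Prop :=
  ∃ C : Ty × Lab, ∃ t : Ty, ∃ ts : Set Ty, ts.Nonempty ∧
    (∀ G ∈ Lang S, ∀ n ∈ G.nodes, t ∈ G.typing n → ∃ s ∈ ts, s ∈ G.typing n) ∧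
    (∀ s ∈ ts, maxarity S C s = ⊤) ∧
    maxarity S C t ≠ ⊤ ∧
    S'.arity C.1 C.2 t = ((S.arity C.1 C.2 t).1, (⊤ : ℕ∞)) ∧
    ∀ u a s, ¬((u, a) = C ∧ s = t) → S'.arity u a s = S.arity u a s

/-- A single application of rule (R3) in some context. -/
def R3Step (S S' : ShapeGraph Lab Ty) : Prop :=
  ∃ C : Ty × Lab, ∃ t t' : Ty, ∃ ts : Set Ty, ts.Nonempty ∧
    (∀ G ∈ Lang S,
      {n | n ∈ G.nodes ∧ t ∈ G.typing n ∧ ∀ s ∈ ts, s ∉ G.typing n} =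
      {n | n ∈ G.nodes ∧ t' ∈ G.typing n ∧ ∀ s ∈ ts, s ∉ G.typing n}) ∧
    lt t t' ∧
    S.arity C.1 C.2 t' = ((0 : ℕ), (0 : ℕ∞)) ∧
    S.arity C.1 C.2 t = ((0 : ℕ), (1 : ℕ∞)) ∧
    (∀ s ∈ ts, maxarity S C s = ⊤) ∧
    S'.arity C.1 C.2 t = ((0 : ℕ), (0 : ℕ∞)) ∧
    S'.arity C.1 C.2 t' = ((0 : ℕ), (1 : ℕ∞)) ∧
    ∀ u a s, ¬((u, a) = C ∧ (s = t ∨ s = t')) → S'.arity u a s = S.arity u a s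

/-- `S'` is obtained from `S` by exhaustive application of the step relation `Step`:
    reachable by finitely many steps, with no further step applicable. -/
def NF (Step : ShapeGraph Lab Ty → ShapeGraph Lab Ty → Prop)
    (S S' : ShapeGraph Lab Ty) : Prop :=
  Relation.ReflTransGen Step S S' ∧ ∀ S'', ¬ Step S' S''

/-- `CanRel lt S S3` holds iff `S3` is a result `Can^<(S)` of the canonization procedure:
    exhaustive (R1), then exhaustive (R2), then exhaustive (R3). -/
def CanRel (S S3 : ShapeGraph Lab Ty) : Prop :=
  ∃ S1 S2, NF (R1Step lt) S S1 ∧ NF (R2Step) S1 S2 ∧ NF (R3Step lt) S2 S3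

end Rules

/-- Disjoint union of typed graphs, realized on `ℕ` via even/odd encoding. -/
def TypedGraph.dunion (G G' : TypedGraph Lab Ty) : TypedGraph Lab Ty where
  nodes := (fun n => 2 * n) '' G.nodes ∪ (fun n => 2 * n + 1) '' G'.nodes
  edges := (fun e : ℕ × Lab × ℕ => (2 * e.1, e.2.1, 2 * e.2.2)) '' G.edges ∪
           (fun e : ℕ × Lab × ℕ => (2 * e.1 + 1, e.2.1, 2 * e.2.2 + 1)) '' G'.edges
  typing := fun n => if n % 2 = 0 then G.typing (n / 2) else G'.typing (n / 2)
  nodes_finite := (G.nodes_finite.image _).union (G'.nodes_finite.image _)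
  edges_sub := by
    rintro e (⟨f, hf, rfl⟩ | ⟨f, hf, rfl⟩)
    · exact ⟨Set.mem_union_left _ ⟨f.1, (G.edges_sub f hf).1, rfl⟩,
        Set.mem_union_left _ ⟨f.2.2, (G.edges_sub f hf).2, rfl⟩⟩
    · exact ⟨Set.mem_union_right _ ⟨f.1, (G'.edges_sub f hf).1, rfl⟩,
        Set.mem_union_right _ ⟨f.2.2, (G'.edges_sub f hf).2, rfl⟩⟩

end ShEx0

end

namespace ShEx0

variable {Lab Ty : Type}

/-- The basic intervals form a finite set. -/
theorem finite_setOf_ivBasic : {p : ℕ × ℕ∞ | IvBasic p}.Finite := by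
  refine (((Set.finite_Iic (1 : ℕ))).prod
    ((Set.finite_Iic (1 : ℕ)).image (fun n : ℕ => (n : ℕ∞)) |>.insert ⊤)).subset ?_
  rintro ⟨a, b⟩ ⟨ha, hb⟩
  refine ⟨ha, ?_⟩
  rcases hb with hb | hb
  · right
    lift b to ℕ using ne_top_of_le_ne_top (by simp) hb
    have hb' : (b : ℕ∞) ≤ 1 := hb
    exact ⟨b, Set.mem_Iic.2 (by exact_mod_cast hb'), rfl⟩
  · exact Or.inl hb

instance [Finite Lab] [Finite Ty] : Finite (ShapeGraph Lab Ty) := by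
  have : Finite {p : ℕ × ℕ∞ // IvBasic p} := finite_setOf_ivBasic.to_subtype
  refine Finite.of_injective
    (fun S : ShapeGraph Lab Ty => fun t a s =>
      (⟨S.arity t a s, S.basic t a s⟩ : {p : ℕ × ℕ∞ // IvBasic p})) ?_
  rintro ⟨f, hf⟩ ⟨g, hg⟩ h
  have : f = g := by
    funext t a s
    exact congrArg Subtype.val (congrFun (congrFun (congrFun h t) a) s)
  subst this
  rfl

/-- The action of a map of nodes on edges. -/
def mapEdge (f : ℕ → ℕ) (e : ℕ × Lab × ℕ) : ℕ × Lab × ℕ := (f e.1, e.2.1, f e.2.2)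

theorem mapEdge_injective {f : ℕ → ℕ} (hf : f.Injective) :
    (mapEdge (Lab := Lab) f).Injective := by
  rintro ⟨a, b, c⟩ ⟨a', b', c'⟩ h
  simp only [mapEdge, Prod.mk.injEq] at h
  rw [hf h.1, h.2.1, hf h.2.2]

/-- Satisfaction is invariant under embeddings that preserve outbound neighborhoods. -/
theorem sat_iff_of_out_eq {S : ShapeGraph Lab Ty} {G H : TypedGraph Lab Ty} {f : ℕ → ℕ}
    (hf : f.Injective) (hout : ∀ n, H.out (f n) = mapEdge f '' G.out n) (n : ℕ) (t : Ty) :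
    Sat S H (f n) t ↔ Sat S G n t := by
  have hinj := mapEdge_injective (Lab := Lab) hf
  constructor
  · rintro ⟨R, hR, hn⟩
    refine ⟨fun m s => R (f m) s, fun m s hm => ?_, hn⟩
    obtain ⟨lam, h1, h2⟩ := hR _ _ hm
    refine ⟨lam ∘ mapEdge f, fun e he => h1 (mapEdge f e) (hout m ▸ ⟨e, he, rfl⟩), fun a u => ?_⟩
    convert h2 a u using 1
    rw [← Set.ncard_image_of_injective _ hinj, hout]
    congr 1
    ext e
    constructor
    · rintro ⟨e, ⟨he, ha, hl⟩, rfl⟩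
      exact ⟨⟨e, he, rfl⟩, ha, hl⟩
    · rintro ⟨⟨e, he, rfl⟩, ha, hl⟩
      exact ⟨e, ⟨he, ha, hl⟩, rfl⟩
  · rintro ⟨R, hR, hn⟩
    refine ⟨fun m s => ∃ k, f k = m ∧ R k s, ?_, n, rfl, hn⟩
    rintro _ s ⟨m, rfl, hm⟩
    obtain ⟨lam, h1, h2⟩ := hR _ _ hm
    have hlam : ∀ e, Function.extend (mapEdge f) lam (fun _ => t) (mapEdge f e) = lam e :=
      fun e => hinj.extend_apply _ _ _
    refine ⟨Function.extend (mapEdge f) lam (fun _ => t), ?_, fun a u => ?_⟩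
    · rw [hout]
      rintro _ ⟨e, he, rfl⟩
      exact ⟨e.2.2, rfl, (hlam e).symm ▸ h1 e he⟩
    · convert h2 a u using 1
      rw [← Set.ncard_image_of_injective {e | e ∈ G.out m ∧ e.2.1 = a ∧ lam e = u} hinj, hout]
      congr 1
      ext e
      constructor
      · rintro ⟨⟨e, he, rfl⟩, ha, hl⟩
        exact ⟨e, ⟨he, ha, hlam e ▸ hl⟩, rfl⟩
      · rintro ⟨e, ⟨he, ha, hl⟩, rfl⟩
        exact ⟨⟨e, he, rfl⟩, ha, (hlam e).trans hl⟩

theorem sat_dunion_left (S : ShapeGraph Lab Ty) (G G' : TypedGraph Lab Ty) (n : ℕ) (t : Ty) :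
    Sat S (G.dunion G') (2 * n) t ↔ Sat S G n t := by
  refine sat_iff_of_out_eq (f := fun n => 2 * n) (fun a b h => by simpa using h) (fun m => ?_) n t
  ext e
  constructor
  · rintro ⟨⟨e, he, rfl⟩ | ⟨e, he, rfl⟩, h⟩
    · exact ⟨e, ⟨he, by dsimp only at h; omega⟩, rfl⟩
    · dsimp only at h
      omega
  · rintro ⟨e, ⟨he, rfl⟩, rfl⟩
    exact ⟨Or.inl ⟨e, he, rfl⟩, rfl⟩

theorem sat_dunion_right (S : ShapeGraph Lab Ty) (G G' : TypedGraph Lab Ty) (n : ℕ) (t : Ty) :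
    Sat S (G.dunion G') (2 * n + 1) t ↔ Sat S G' n t := by
  refine sat_iff_of_out_eq (f := fun n => 2 * n + 1) (fun a b h => by simpa using h)
    (fun m => ?_) n t
  ext e
  constructor
  · rintro ⟨⟨e, he, rfl⟩ | ⟨e, he, rfl⟩, h⟩
    · dsimp only at h
      omega
    · exact ⟨e, ⟨he, by dsimp only at h; omega⟩, rfl⟩
  · rintro ⟨e, ⟨he, rfl⟩, rfl⟩
    exact ⟨Or.inr ⟨e, he, rfl⟩, rfl⟩

theorem typing_dunion_left (G G' : TypedGraph Lab Ty) (n : ℕ) :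
    (G.dunion G').typing (2 * n) = G.typing n := by
  simp [TypedGraph.dunion]

theorem typing_dunion_right (G G' : TypedGraph Lab Ty) (n : ℕ) :
    (G.dunion G').typing (2 * n + 1) = G'.typing n := by
  have h : (2 * n + 1) / 2 = n := by omega
  simp [TypedGraph.dunion, h]

/-- A disjoint union belongs to a language iff both components do. -/
theorem dunion_mem_lang {S : ShapeGraph Lab Ty} {G G' : TypedGraph Lab Ty} :
    G.dunion G' ∈ Lang S ↔ G ∈ Lang S ∧ G' ∈ Lang S := by
  have hnodes : ∀ P : ℕ → Prop, (∀ n ∈ (G.dunion G').nodes, P n) ↔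
      (∀ n ∈ G.nodes, P (2 * n)) ∧ ∀ n ∈ G'.nodes, P (2 * n + 1) := fun P => by
    simp [TypedGraph.dunion, or_imp, forall_and]
  simp only [Lang, Set.mem_ofPred_eq, hnodes, sat_dunion_left, sat_dunion_right,
    typing_dunion_left, typing_dunion_right]
  tauto

/-- The graph without nodes. -/
def emptyGraph : TypedGraph Lab Ty where
  nodes := ∅
  edges := ∅
  typing := fun _ => ∅
  nodes_finite := Set.finite_empty
  edges_sub := by simp

theorem emptyGraph_mem_lang (S : ShapeGraph Lab Ty) : emptyGraph ∈ Lang S := by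
  simp [Lang, emptyGraph]

/-- A single graph of `Lang S` separates `Lang S` from each of finitely many languages that do
not contain it. -/
theorem exists_separating_graph (S : ShapeGraph Lab Ty) {A : Set (ShapeGraph Lab Ty)}
    (hA : A.Finite) : ∃ G ∈ Lang S, ∀ S' ∈ A, G ∈ Lang S' → Lang S ⊆ Lang S' := by
  induction A, hA using Set.Finite.induction_on with
  | empty => exact ⟨emptyGraph, emptyGraph_mem_lang S, by simp⟩
  | @insert T A _ _ ih =>
    obtain ⟨G, hG, hGA⟩ := ih
    obtain ⟨H, hH, hHT⟩ : ∃ H ∈ Lang S, H ∈ Lang T → Lang S ⊆ Lang T := by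
      by_contra! h
      exact (h _ (emptyGraph_mem_lang S)).2 fun H hH => (h H hH).1
    refine ⟨H.dunion G, dunion_mem_lang.2 ⟨hH, hG⟩, ?_⟩
    rintro S' (rfl | hS') h
    · exact hHT (dunion_mem_lang.1 h).1
    · exact hGA S' hS' (dunion_mem_lang.1 h).2

/-- Among the shape graphs whose language contains a given graph, one has minimal language. -/
theorem exists_minimal_lang [Finite Lab] [Finite Ty] {G : TypedGraph Lab Ty}
    (h : ∃ S : ShapeGraph Lab Ty, G ∈ Lang S) :
    ∃ S : ShapeGraph Lab Ty, MinimalFor (fun S : ShapeGraph Lab Ty => G ∈ Lang S) Lang S :=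
  (Set.toFinite {S : ShapeGraph Lab Ty | G ∈ Lang S}).exists_minimalFor Lang _ h

end ShEx0

open ShEx0 in
theorem shex0_learnable {Lab Ty : Type} [Fintype Lab] [Fintype Ty] [Nonempty Lab] [Nonempty Ty] :
    ∃ learner : TypedGraph Lab Ty → ShapeGraph Lab Ty,
      (∀ G : TypedGraph Lab Ty, (∃ S : ShapeGraph Lab Ty, G ∈ Lang S) →
        G ∈ Lang (learner G)) ∧
      (∀ S : ShapeGraph Lab Ty, ∃ G ∈ Lang S, ∀ G' ∈ Lang S,
        Lang (learner (G.dunion G')) = Lang S) := by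
  have hlearn : ∀ G : TypedGraph Lab Ty, ∃ S : ShapeGraph Lab Ty,
      (∃ S : ShapeGraph Lab Ty, G ∈ Lang S) →
        MinimalFor (fun S : ShapeGraph Lab Ty => G ∈ Lang S) Lang S := fun G => by
    by_cases h : ∃ S : ShapeGraph Lab Ty, G ∈ Lang S
    · obtain ⟨S, hS⟩ := exists_minimal_lang h
      exact ⟨S, fun _ => hS⟩
    · exact ⟨⟨fun _ _ _ => (0, 0), fun _ _ _ => ⟨by simp, by simp⟩⟩, fun h' => absurd h' h⟩
  choose learner hlearner using hlearn
  refine ⟨learner, fun G hG => (hlearner G hG).prop, fun S => ?_⟩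
  obtain ⟨G, hG, hsep⟩ := exists_separating_graph S (Set.toFinite Set.univ)
  refine ⟨G, hG, fun G' hG' => ?_⟩
  have hmem : G.dunion G' ∈ Lang S := dunion_mem_lang.2 ⟨hG, hG'⟩
  have hmin := hlearner _ ⟨S, hmem⟩
  have hsub := hsep _ (Set.mem_univ _) (dunion_mem_lang.1 hmin.prop).1
  exact (hmin.le_of_le hmem hsub).antisymm hsub
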